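/- (Nontriviality criterion.) Let T = {T_x}_{x=1}^m and S = {S_y}_{y=1}^m be two testers with roulette vector w. If there is no common eigencircuit, i.e. no process comb J and indices x, y with Tr[J T_x] = 1 and Tr[J S_y] = 1, then H(w) > 1, i.e. the incompatibility constant C(T,S) := 2H(w) − 2 is strictly positive. -/

import Mathlib

open Matrix BigOperators ComplexOrder

noncomputable section

/-- Index type for the three systems A, B, C. -/
abbrev PIdx (dA dB dC : ℕ) := Fin dA × Fin dB × Fin dC

/-- Matrices on `ℂ^{dA} ⊗ ℂ^{dB} ⊗ ℂ^{dC}`. -/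
abbrev PMat (dA dB dC : ℕ) := Matrix (PIdx dA dB dC) (PIdx dA dB dC) ℂ

/-- Partial trace over the third (C) tensor factor. -/
def trC {dA dB dC : ℕ} (M : PMat dA dB dC) :
    Matrix (Fin dA × Fin dB) (Fin dA × Fin dB) ℂ :=
  Matrix.of fun i j => ∑ c : Fin dC, M (i.1, i.2, c) (j.1, j.2, c)

/-- Partial trace over the second tensor factor of a bipartite matrix. -/
def trSnd {d₁ d₂ : ℕ} (M : Matrix (Fin d₁ × Fin d₂) (Fin d₁ × Fin d₂) ℂ) :
    Matrix (Fin d₁) (Fin d₁) ℂ :=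
  Matrix.of fun a a' => ∑ b : Fin d₂, M (a, b) (a', b)

/-- A process comb: a PSD matrix `J` on A ⊗ B ⊗ C with `Tr_C J = ρ_A ⊗ I_B`
for some state `ρ_A`. -/
def IsProcessComb {dA dB dC : ℕ} (J : PMat dA dB dC) : Prop :=
  J.PosSemidef ∧ ∃ ρ : Matrix (Fin dA) (Fin dA) ℂ,
    ρ.PosSemidef ∧ ρ.trace = 1 ∧
    trC J = Matrix.of fun i j => ρ i.1 j.1 * (if i.2 = j.2 then (1 : ℂ) else 0)

/-- A tester with `m` outcomes: PSD matrices `T x` with `∑ x, T x = Λ ⊗ I_C`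
for some PSD `Λ` on A ⊗ B with `Tr_B Λ = I_A`. -/
def IsTester {dA dB dC m : ℕ} (T : Fin m → PMat dA dB dC) : Prop :=
  (∀ x, (T x).PosSemidef) ∧
  ∃ Λ : Matrix (Fin dA × Fin dB) (Fin dA × Fin dB) ℂ,
    Λ.PosSemidef ∧ trSnd Λ = 1 ∧
    (∑ x, T x) = Matrix.of fun i j =>
      Λ (i.1, i.2.1) (j.1, j.2.1) * (if i.2.2 = j.2.2 then (1 : ℂ) else 0)

/-- Outcome probability `Tr[J T]` (as a real number). -/
def prob {dA dB dC : ℕ} (J T : PMat dA dB dC) : ℝ := ((J * T).trace).re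

/-- `P_k`: Bob's optimal winning probability in the quantum roulette with `k` chips,
for the pair of testers `T`, `S`. -/
def rouletteP {dA dB dC m : ℕ} (T S : Fin m → PMat dA dB dC) (k : ℕ) : ℝ :=
  sSup { r : ℝ | ∃ J : PMat dA dB dC, IsProcessComb J ∧
    ∃ G : Finset (Fin 2 × Fin m), G.card = k ∧
      r = ∑ g ∈ G, (1 / 2 : ℝ) * prob J (if g.1 = 0 then T g.2 else S g.2) }

/-- The roulette vector `w ∈ ℝ^{2m}`, `w_k = P_k - P_{k-1}`. -/
def rouletteW {dA dB dC m : ℕ} (T S : Fin m → PMat dA dB dC) : Fin (m + m) → ℝ :=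
  fun k => rouletteP T S (k.1 + 1) - rouletteP T S k.1

/-- Sum of the `k` largest entries of a (nonnegative) vector, padding with zeros. -/
def kMaxSum {n : ℕ} (u : Fin n → ℝ) (k : ℕ) : ℝ :=
  sSup { r : ℝ | ∃ A : Finset (Fin n), A.card = min k n ∧ r = ∑ i ∈ A, u i }

/-- `MajorizedBy u v` means `u ≺ v`: every partial sum of the `k` largest entries of `u`
is at most that of `v`, and the total sums agree. -/
def MajorizedBy {m n : ℕ} (u : Fin m → ℝ) (v : Fin n → ℝ) : Prop :=
  (∀ k : ℕ, kMaxSum u k ≤ kMaxSum v k) ∧ ∑ i, u i = ∑ i, v i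

/-- Base-2 Shannon entropy of a finite vector. -/
def H2 {n : ℕ} (p : Fin n → ℝ) : ℝ := -∑ i, p i * Real.logb 2 (p i)

lemma continuous_entry {n : Type*} (i j : n) : Continuous fun M : Matrix n n ℂ => M i j :=
  (continuous_apply j).comp (continuous_apply i)

lemma isClosed_setOf_posSemidef {n : Type*} [Fintype n] :
    IsClosed {M : Matrix n n ℂ | M.PosSemidef} := by
  simp only [Matrix.posSemidef_iff_dotProduct_mulVec, Set.ofPred_and, Set.ofPred_forall]
  refine IsClosed.inter ?_ (isClosed_iInter fun x => ?_)
  · exact isClosed_eq (continuous_id.matrix_conjTranspose) continuous_id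
  · exact isClosed_le continuous_const
      (Continuous.dotProduct continuous_const (Continuous.matrix_mulVec continuous_id continuous_const))

lemma Matrix.PosSemidef.norm_apply_le_re_trace {n : Type*} [Fintype n] {M : Matrix n n ℂ}
    (hM : M.PosSemidef) (i j : n) : ‖M i j‖ ≤ M.trace.re := by
  obtain ⟨k, v, rfl⟩ := Matrix.posSemidef_iff_eq_sum_vecMulVec.mp hM
  have htr : (∑ l, vecMulVec (v l) (star (v l))).trace.re = ∑ l, ∑ p, ‖v l p‖ ^ 2 := by
    simp only [Matrix.trace_sum, Complex.re_sum]
    refine Finset.sum_congr rfl fun l _ => ?_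
    simp only [Matrix.trace, Matrix.diag, vecMulVec_apply, Complex.re_sum]
    refine Finset.sum_congr rfl fun p _ => ?_
    simp [Complex.mul_conj, ← Complex.normSq_eq_norm_sq, -Complex.mul_re]
  rw [htr, Matrix.sum_apply]
  refine (norm_sum_le _ _).trans (Finset.sum_le_sum fun l _ => ?_)
  have hi := Finset.single_le_sum (f := fun p => ‖v l p‖ ^ 2) (fun p _ => sq_nonneg _)
    (Finset.mem_univ i)
  have hj := Finset.single_le_sum (f := fun p => ‖v l p‖ ^ 2) (fun p _ => sq_nonneg _)
    (Finset.mem_univ j)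
  simp only [vecMulVec_apply, Pi.star_apply, norm_mul, norm_star]
  nlinarith [sq_nonneg (‖v l i‖ - ‖v l j‖)]

lemma Matrix.PosSemidef.re_trace_mul_nonneg {n : Type*} [Fintype n] {J M : Matrix n n ℂ}
    (hJ : J.PosSemidef) (hM : M.PosSemidef) : 0 ≤ (J * M).trace.re := by
  obtain ⟨k, v, rfl⟩ := Matrix.posSemidef_iff_eq_sum_vecMulVec.mp hM
  simp only [Matrix.mul_sum, Matrix.trace_sum, Complex.re_sum]
  refine Finset.sum_nonneg fun l _ => ?_
  rw [Matrix.mul_vecMulVec, Matrix.trace_vecMulVec, dotProduct_comm]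
  exact (Complex.nonneg_iff.mp (hJ.dotProduct_mulVec_nonneg (v l))).1

lemma isCompact_posSemidef_trace_eq {n : Type*} [Fintype n] (t : ℂ) :
    IsCompact {M : Matrix n n ℂ | M.PosSemidef ∧ M.trace = t} := by
  refine IsCompact.of_isClosed_subset (s := Set.univ.pi fun _ : n => Set.univ.pi fun _ : n =>
    Metric.closedBall (0 : ℂ) t.re)
    (isCompact_univ_pi fun _ => isCompact_univ_pi fun _ => isCompact_closedBall _ _)
    (isClosed_setOf_posSemidef.inter
      (isClosed_eq (Continuous.matrix_trace continuous_id) continuous_const)) ?_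
  rintro M ⟨hM, rfl⟩
  simpa [Set.mem_pi] using hM.norm_apply_le_re_trace

section Roulette

variable {dA dB dC m : ℕ}

lemma trace_trC (J : PMat dA dB dC) : (trC J).trace = J.trace := by
  simp [trC, Matrix.trace, Fintype.sum_prod_type]

lemma continuous_trC : Continuous fun J : PMat dA dB dC => trC J := by
  refine continuous_matrix fun i j => ?_
  simp only [trC, Matrix.of_apply]
  exact continuous_finsetSum _ fun c _ =>
    continuous_entry (n := PIdx dA dB dC) (i.1, i.2, c) (j.1, j.2, c)

lemma isCompact_setOf_isProcessComb : IsCompact {J : PMat dA dB dC | IsProcessComb J} := by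
  have hclosed : IsClosed {p : PMat dA dB dC × Matrix (Fin dA) (Fin dA) ℂ |
      trC p.1 = Matrix.of fun i j => p.2 i.1 j.1 * (if i.2 = j.2 then (1 : ℂ) else 0)} := by
    refine isClosed_eq ?_ (continuous_matrix fun i j => ?_)
    · exact continuous_trC.comp continuous_fst
    · exact ((continuous_entry i.1 j.1).comp continuous_snd).mul continuous_const
  have hK := (((isCompact_posSemidef_trace_eq (n := PIdx dA dB dC) (dB : ℂ)).prod
    (isCompact_posSemidef_trace_eq (n := Fin dA) 1)).inter_right hclosed).image continuous_fst
  convert hK using 1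
  ext J
  constructor
  · rintro ⟨hJ, ρ, hρ, htr, h⟩
    refine ⟨(J, ρ), ⟨⟨⟨hJ, ?_⟩, hρ, htr⟩, h⟩, rfl⟩
    rw [← trace_trC, h]
    simp only [Matrix.trace, Matrix.diag, Matrix.of_apply, if_true, mul_one,
      Fintype.sum_prod_type, Finset.sum_const, Finset.card_univ, Fintype.card_fin, nsmul_eq_mul]
    rw [← Finset.mul_sum]
    simp only [Matrix.trace, Matrix.diag] at htr
    rw [htr, mul_one]
  · rintro ⟨⟨J', ρ⟩, ⟨⟨⟨hJ, -⟩, hρ, htr⟩, h⟩, rfl⟩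
    exact ⟨hJ, ρ, hρ, htr, h⟩

lemma exists_isProcessComb (hA : 0 < dA) (hC : 0 < dC) : ∃ J : PMat dA dB dC, IsProcessComb J := by
  have hA' : (dA : ℂ) ≠ 0 := by exact_mod_cast hA.ne'
  have hC' : (dC : ℂ) ≠ 0 := by exact_mod_cast hC.ne'
  refine ⟨diagonal fun _ => ((dA : ℂ) * dC)⁻¹, PosSemidef.diagonal fun _ => ?_,
    diagonal fun _ => (dA : ℂ)⁻¹, PosSemidef.diagonal fun _ => ?_, ?_, ?_⟩
  · simp only [Pi.zero_apply]
    positivity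
  · simp only [Pi.zero_apply]
    positivity
  · simp [hA']
  · ext ⟨a, b⟩ ⟨a', b'⟩
    by_cases ha : a = a' <;> by_cases hb : b = b' <;>
      simp [trC, diagonal_apply, ha, hb]
    field_simp

lemma prob_nonneg {J M : PMat dA dB dC} (hJ : IsProcessComb J) (hM : M.PosSemidef) :
    0 ≤ prob J M :=
  hJ.1.re_trace_mul_nonneg hM

lemma continuous_prob (M : PMat dA dB dC) : Continuous fun J => prob J M :=
  Complex.continuous_re.comp (Continuous.matrix_trace (continuous_id.mul continuous_const))

lemma sum_prob {T : Fin m → PMat dA dB dC} (hT : IsTester T) {J : PMat dA dB dC}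
    (hJ : IsProcessComb J) : ∑ x, prob J (T x) = 1 := by
  obtain ⟨-, Λ, -, hΛ, hsum⟩ := hT
  obtain ⟨-, ρ, -, hρ, hJρ⟩ := hJ
  have key : (J * ∑ x, T x).trace = 1 := by
    have h1 : (J * ∑ x, T x).trace = (trC J * Λ).trace := by
      rw [hsum]
      simp only [Matrix.trace, Matrix.diag, Matrix.mul_apply, Matrix.of_apply,
        Fintype.sum_prod_type, trC, mul_ite, mul_one, mul_zero, Finset.sum_ite_eq',
        Finset.mem_univ, if_true, Finset.sum_mul]
      refine Finset.sum_congr rfl fun a _ => Finset.sum_congr rfl fun b _ => ?_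
      rw [Finset.sum_comm]
      refine Finset.sum_congr rfl fun a' _ => ?_
      rw [Finset.sum_comm]
    have h2 : (trC J * Λ).trace = (ρ * trSnd Λ).trace := by
      rw [hJρ]
      simp only [Matrix.trace, Matrix.diag, Matrix.mul_apply, Matrix.of_apply,
        Fintype.sum_prod_type, trSnd, mul_ite, ite_mul, zero_mul, mul_one, mul_zero,
        Finset.sum_ite_eq, Finset.mem_univ, if_true, Finset.mul_sum]
      refine Finset.sum_congr rfl fun a _ => ?_
      rw [Finset.sum_comm]
    rw [h1, h2, hΛ, mul_one, hρ]
  simp only [prob]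
  rw [← Complex.re_sum, ← Matrix.trace_sum, ← Matrix.mul_sum, key, Complex.one_re]

/-- The probability that the chip `g` wins the roulette on the process comb `J`. -/
def chipProb (T S : Fin m → PMat dA dB dC) (J : PMat dA dB dC) (g : Fin 2 × Fin m) : ℝ :=
  (1 / 2 : ℝ) * prob J (if g.1 = 0 then T g.2 else S g.2)

/-- The winning probabilities achievable with `k` chips. -/
def rouletteValues (T S : Fin m → PMat dA dB dC) (k : ℕ) : Set ℝ :=
  { r : ℝ | ∃ J : PMat dA dB dC, IsProcessComb J ∧
    ∃ G : Finset (Fin 2 × Fin m), G.card = k ∧ r = ∑ g ∈ G, chipProb T S J g }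

lemma rouletteP_eq (T S : Fin m → PMat dA dB dC) (k : ℕ) :
    rouletteP T S k = sSup (rouletteValues T S k) := rfl

lemma isCompact_rouletteValues (T S : Fin m → PMat dA dB dC) (k : ℕ) :
    IsCompact (rouletteValues T S k) := by
  have h := (Set.toFinite {G : Finset (Fin 2 × Fin m) | G.card = k}).isCompact_biUnion
    (f := fun G => (fun J => ∑ g ∈ G, chipProb T S J g) '' {J | IsProcessComb J})
    fun G _ => isCompact_setOf_isProcessComb.image
      (continuous_finsetSum _ fun g _ => continuous_const.mul (continuous_prob _))
  convert h using 1
  ext r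
  simp only [rouletteValues, Set.mem_ofPred_eq, Set.mem_iUnion, Set.mem_image, exists_prop]
  constructor
  · rintro ⟨J, hJ, G, hG, rfl⟩
    exact ⟨G, hG, J, hJ, rfl⟩
  · rintro ⟨G, hG, J, hJ, rfl⟩
    exact ⟨J, hJ, G, hG, rfl⟩

lemma le_rouletteP (T S : Fin m → PMat dA dB dC) {J : PMat dA dB dC} (hJ : IsProcessComb J)
    (G : Finset (Fin 2 × Fin m)) : ∑ g ∈ G, chipProb T S J g ≤ rouletteP T S G.card :=
  le_csSup (isCompact_rouletteValues T S _).bddAbove ⟨J, hJ, G, rfl, rfl⟩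

lemma exists_rouletteP_eq (hA : 0 < dA) (hC : 0 < dC) (T S : Fin m → PMat dA dB dC) {k : ℕ}
    (hk : k ≤ m + m) :
    ∃ J : PMat dA dB dC, IsProcessComb J ∧
      ∃ G : Finset (Fin 2 × Fin m), G.card = k ∧ rouletteP T S k = ∑ g ∈ G, chipProb T S J g := by
  refine (isCompact_rouletteValues T S k).sSup_mem ?_
  obtain ⟨J, hJ⟩ := exists_isProcessComb (dB := dB) hA hC
  obtain ⟨G, -, hG⟩ := Finset.exists_subset_card_eq
    (s := (Finset.univ : Finset (Fin 2 × Fin m))) (n := k) (by simpa [two_mul] using hk)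
  exact ⟨_, J, hJ, G, hG, rfl⟩

variable {T S : Fin m → PMat dA dB dC} {J : PMat dA dB dC}

lemma chipProb_nonneg (hT : IsTester T) (hS : IsTester S) (hJ : IsProcessComb J)
    (g : Fin 2 × Fin m) : 0 ≤ chipProb T S J g := by
  refine mul_nonneg (by norm_num) (prob_nonneg hJ ?_)
  split_ifs
  exacts [hT.1 _, hS.1 _]

lemma sum_chipProb_row (hT : IsTester T) (hS : IsTester S) (hJ : IsProcessComb J) (i : Fin 2) :
    ∑ x, chipProb T S J (i, x) = 1 / 2 := by
  simp only [chipProb, ← Finset.mul_sum]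
  split_ifs
  · rw [sum_prob hT hJ, mul_one]
  · rw [sum_prob hS hJ, mul_one]

lemma sum_chipProb (hT : IsTester T) (hS : IsTester S) (hJ : IsProcessComb J) :
    ∑ g, chipProb T S J g = 1 := by
  rw [Fintype.sum_prod_type]
  simp only [sum_chipProb_row hT hS hJ]
  norm_num

lemma chipProb_le_half (hT : IsTester T) (hS : IsTester S) (hJ : IsProcessComb J)
    (g : Fin 2 × Fin m) : chipProb T S J g ≤ 1 / 2 := by
  rw [← sum_chipProb_row hT hS hJ g.1]
  exact Finset.single_le_sum (f := fun x => chipProb T S J (g.1, x))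
    (fun x _ => chipProb_nonneg hT hS hJ _) (Finset.mem_univ g.2)

lemma chipProb_add_le_half (hT : IsTester T) (hS : IsTester S) (hJ : IsProcessComb J)
    (i : Fin 2) {x y : Fin m} (hxy : x ≠ y) :
    chipProb T S J (i, x) + chipProb T S J (i, y) ≤ 1 / 2 := by
  rw [← sum_chipProb_row hT hS hJ i, ← Finset.sum_pair (f := fun x => chipProb T S J (i, x)) hxy]
  exact Finset.sum_le_sum_of_subset_of_nonneg (Finset.subset_univ _)
    fun z _ _ => chipProb_nonneg hT hS hJ _

lemma rouletteP_zero (hA : 0 < dA) (hC : 0 < dC) (T S : Fin m → PMat dA dB dC) :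
    rouletteP T S 0 = 0 := by
  obtain ⟨J, -, G, hG, h⟩ := exists_rouletteP_eq hA hC T S (Nat.zero_le _)
  rw [h, Finset.card_eq_zero.mp hG, Finset.sum_empty]

lemma rouletteP_top (hA : 0 < dA) (hC : 0 < dC) (hT : IsTester T) (hS : IsTester S) :
    rouletteP T S (m + m) = 1 := by
  obtain ⟨J, hJ, G, hG, h⟩ := exists_rouletteP_eq hA hC T S le_rfl
  rw [h, (Finset.card_eq_iff_eq_univ G).mp (by simp [hG, two_mul]), sum_chipProb hT hS hJ]

lemma sum_rouletteW (hA : 0 < dA) (hC : 0 < dC) (hT : IsTester T) (hS : IsTester S) :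
    ∑ k, rouletteW T S k = 1 := by
  simp only [rouletteW]
  rw [Fin.sum_univ_eq_sum_range (fun k => rouletteP T S (k + 1) - rouletteP T S k),
    Finset.sum_range_sub, rouletteP_top hA hC hT hS, rouletteP_zero hA hC, sub_zero]

lemma rouletteW_nonneg (hA : 0 < dA) (hC : 0 < dC) (hT : IsTester T) (hS : IsTester S)
    (k : Fin (m + m)) : 0 ≤ rouletteW T S k := by
  obtain ⟨J, hJ, G, hG, h⟩ := exists_rouletteP_eq hA hC T S k.2.le
  obtain ⟨g, hg⟩ : ∃ g, g ∉ G := by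
    by_contra! hall
    have := k.2
    rw [← hG, Finset.eq_univ_iff_forall.mpr hall] at this
    simp [two_mul] at this
  have hle := le_rouletteP T S hJ (insert g G)
  rw [Finset.card_insert_of_notMem hg, Finset.sum_insert hg, hG, ← h] at hle
  have := chipProb_nonneg hT hS hJ g
  simp only [rouletteW]
  linarith

lemma exists_rouletteW_le_chipProb (hA : 0 < dA) (hC : 0 < dC) (T S : Fin m → PMat dA dB dC)
    (k : Fin (m + m)) :
    ∃ J : PMat dA dB dC, IsProcessComb J ∧ ∃ G : Finset (Fin 2 × Fin m), G.card = k.1 + 1 ∧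
      ∀ g ∈ G, rouletteW T S k ≤ chipProb T S J g := by
  obtain ⟨J, hJ, G, hG, h⟩ := exists_rouletteP_eq hA hC T S (Nat.succ_le_of_lt k.2)
  refine ⟨J, hJ, G, hG, fun g hg => ?_⟩
  have hle := le_rouletteP T S hJ (G.erase g)
  rw [Finset.card_erase_of_mem hg, hG] at hle
  have := Finset.add_sum_erase G (chipProb T S J) hg
  simp only [Nat.succ_eq_add_one, Nat.add_sub_cancel] at hle h
  simp only [rouletteW]
  linarith

lemma rouletteW_le_half (hA : 0 < dA) (hC : 0 < dC) (hT : IsTester T) (hS : IsTester S)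
    (k : Fin (m + m)) : rouletteW T S k ≤ 1 / 2 := by
  obtain ⟨J, hJ, G, hG, h⟩ := exists_rouletteW_le_chipProb hA hC T S k
  obtain ⟨g, hg⟩ : G.Nonempty := Finset.card_pos.mp (by omega)
  exact (h g hg).trans (chipProb_le_half hT hS hJ g)

lemma rouletteW_mul_le_one (hA : 0 < dA) (hC : 0 < dC) (hT : IsTester T) (hS : IsTester S)
    (k : Fin (m + m)) : (k.1 + 1) * rouletteW T S k ≤ 1 := by
  obtain ⟨J, hJ, G, hG, h⟩ := exists_rouletteW_le_chipProb hA hC T S k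
  have h1 := Finset.card_nsmul_le_sum G _ _ h
  have h2 : ∑ g ∈ G, chipProb T S J g ≤ ∑ g, chipProb T S J g :=
    Finset.sum_le_sum_of_subset_of_nonneg (Finset.subset_univ _)
      fun g _ _ => chipProb_nonneg hT hS hJ g
  rw [hG, nsmul_eq_mul, Nat.cast_add_one] at h1
  rw [sum_chipProb hT hS hJ] at h2
  exact h1.trans h2

lemma rouletteP_two_lt_one (hA : 0 < dA) (hC : 0 < dC) (hT : IsTester T) (hS : IsTester S)
    (hno : ¬ ∃ (J : PMat dA dB dC) (x y : Fin m),
      IsProcessComb J ∧ prob J (T x) = 1 ∧ prob J (S y) = 1) (hm : 2 ≤ m + m) :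
    rouletteP T S 2 < 1 := by
  obtain ⟨J, hJ, G, hG, h⟩ := exists_rouletteP_eq hA hC T S hm
  obtain ⟨⟨i, x⟩, ⟨j, y⟩, hne, rfl⟩ := Finset.card_eq_two.mp hG
  rw [h, Finset.sum_pair hne]
  by_contra! hge
  have hx := chipProb_le_half hT hS hJ (i, x)
  have hy := chipProb_le_half hT hS hJ (j, y)
  have hx' : chipProb T S J (i, x) = 1 / 2 := by linarith
  have hy' : chipProb T S J (j, y) = 1 / 2 := by linarith
  rcases eq_or_ne i j with rfl | hij
  · have := chipProb_add_le_half hT hS hJ i (x := x) (y := y) (by rintro rfl; exact hne rfl)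
    linarith
  · fin_cases i <;> fin_cases j <;> simp [chipProb] at hij hx' hy'
    · exact hno ⟨J, x, y, hJ, hx', hy'⟩
    · exact hno ⟨J, y, x, hJ, hy', hx'⟩

lemma one_lt_H2 {n : ℕ} {p : Fin n → ℝ} (h0 : ∀ i, 0 ≤ p i) (hle : ∀ i, p i ≤ 1 / 2)
    (hsum : ∑ i, p i = 1) {j : Fin n} (hj : 0 < p j) (hj' : p j < 1 / 2) : 1 < H2 p := by
  have hlog : Real.logb 2 (1 / 2) = -1 := by
    rw [one_div, Real.logb_inv, Real.logb_self_eq_one (by norm_num)]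
  rw [H2, ← Finset.sum_neg_distrib, ← hsum]
  refine Finset.sum_lt_sum (fun i _ => ?_) ⟨j, Finset.mem_univ j, ?_⟩
  · rcases (h0 i).eq_or_lt with h | h
    · simp [← h]
    · have := Real.logb_le_logb_of_le (b := 2) (by norm_num) h (hle i)
      nlinarith
  · have := Real.logb_lt_logb (b := 2) (by norm_num) hj hj'
    nlinarith

end Roulette

theorem incompatibility_constant_positive_of_no_common_eigencircuit
    {dA dB dC m : ℕ} (hA : 0 < dA) (hB : 0 < dB) (hC : 0 < dC)
    (T S : Fin m → PMat dA dB dC) (hT : IsTester T) (hS : IsTester S)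
    (hno : ¬ ∃ (J : PMat dA dB dC) (x y : Fin m),
      IsProcessComb J ∧ prob J (T x) = 1 ∧ prob J (S y) = 1) :
    1 < H2 (rouletteW T S) ∧ 0 < 2 * H2 (rouletteW T S) - 2 := by
  have hm : 0 < m := by
    rcases Nat.eq_zero_or_pos m with rfl | h
    · obtain ⟨J, hJ⟩ := exists_isProcessComb (dB := dB) hA hC
      simpa using sum_prob hT hJ
    · exact h
  have hsum := sum_rouletteW hA hC hT hS
  have hP2 := rouletteP_two_lt_one hA hC hT hS hno (by omega)
  obtain ⟨k, hk2, hk⟩ : ∃ k : Fin (m + m), 2 ≤ k.1 ∧ 0 < rouletteW T S k := by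
    by_contra! hall
    have hconst : ∀ n, 2 ≤ n → n ≤ m + m → rouletteP T S n ≤ rouletteP T S 2 := by
      intro n hn
      induction n, hn using Nat.le_induction with
      | base => exact fun _ => le_rfl
      | succ n hn ih =>
        intro hle
        have := hall ⟨n, hle⟩ hn
        simp only [rouletteW] at this
        linarith [ih (by omega)]
    have := hconst (m + m) (by omega) le_rfl
    rw [rouletteP_top hA hC hT hS] at this
    linarith
  have hk' : rouletteW T S k < 1 / 2 := by
    have h1 := rouletteW_mul_le_one hA hC hT hS k
    have h2 : (2 : ℝ) ≤ k.1 := by exact_mod_cast hk2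
    nlinarith
  have hH := one_lt_H2 (rouletteW_nonneg hA hC hT hS) (rouletteW_le_half hA hC hT hS) hsum hk hk'
  exact ⟨hH, by linarith⟩
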